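/- arXiv:2307.10332 — 7 statements merged into one kernel-verified Lean document; each statement's English description precedes it below -/
import Mathlib

section
/- Let (G,W,S,⪯,s) be an independent POSP instance on a digraph G = (V,A). Then the instance is subpath optimal, i.e., for every t ∈ V, every efficient s,t-path p = (v₁,…,vₙ) has the property that every prefix (v₁,…,vᵢ), 1 ≤ i ≤ n, is an efficient s,vᵢ-path. -/
/-- A path in the digraph with arc relation `A`: a nonempty list of vertices in which
consecutive vertices are joined by arcs. -/
def IsPath {V : Type*} (A : V → V → Prop) (p : List V) : Prop :=
  p ≠ [] ∧ p.Chain' A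

/-- An `s,t`-path: a path starting at `s` and ending at `t`. -/
def IsStPath {V : Type*} (A : V → V → Prop) (s t : V) (p : List V) : Prop :=
  IsPath A p ∧ p.head? = some s ∧ p.getLast? = some t

/-- An efficient `s,t`-path: an `s,t`-path such that no `s,t`-path has strictly
smaller weight (`W q < W p` iff `W q ⪯ W p` and `W q ≠ W p` in a partial order). -/
def EfficientPath {V S : Type*} [PartialOrder S] (A : V → V → Prop) (s : V)
    (W : List V → S) (t : V) (p : List V) : Prop :=
  IsStPath A s t p ∧ ∀ q : List V, IsStPath A s t q → ¬ W q < W p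

/-- Independence: `W p ≺ W q` implies `W (p+a) ≺ W (q+a)` for arcs `a` out of the
common endpoint. -/
def Independent {V S : Type*} [PartialOrder S] (A : V → V → Prop) (s : V)
    (W : List V → S) : Prop :=
  ∀ v u : V, A v u → ∀ p q : List V, IsStPath A s v p → IsStPath A s v q →
    W p < W q → W (p ++ [u]) < W (q ++ [u])

/-- A path `p = (v₁,…,vₙ)` is subpath optimal if every prefix `(v₁,…,vᵢ)` is an
efficient `s,vᵢ`-path. -/
def SubpathOptimalPath {V S : Type*} [PartialOrder S] (A : V → V → Prop) (s : V)
    (W : List V → S) (p : List V) : Prop :=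
  ∀ (i : ℕ) (h : i < p.length), EfficientPath A s W (p[i]'h) (p.take (i + 1))

theorem IsStPath.append_singleton {V : Type*} {A : V → V → Prop} {s v u : V} {p : List V}
    (hp : IsStPath A s v p) (hvu : A v u) : IsStPath A s u (p ++ [u]) := by
  obtain ⟨⟨hne, hc⟩, hs, ht⟩ := hp
  refine ⟨⟨by simp, ?_⟩, ?_, by simp⟩
  · refine List.isChain_append.2 ⟨hc, by simp, ?_⟩
    intro x hx y hy
    simp_all
  · rw [List.head?_append_of_ne_nil _ hne, hs]

theorem EfficientPath.of_append_singleton {V S : Type*} [PartialOrder S] {A : V → V → Prop}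
    {s t u v : V} {W : List V → S} (hInd : Independent A s W) {p : List V}
    (h : EfficientPath A s W t (p ++ [u])) (hv : p.getLast? = some v) :
    EfficientPath A s W v p := by
  obtain ⟨⟨⟨-, hc⟩, hs, ht⟩, heff⟩ := h
  have hne : p ≠ [] := by rintro rfl; simp at hv
  obtain rfl : u = t := by simpa using ht
  obtain ⟨hcp, -, harc⟩ := List.isChain_append.1 hc
  have hvu : A v u := harc v hv u (by simp)
  have hp : IsStPath A s v p :=
    ⟨⟨hne, hcp⟩, by rwa [List.head?_append_of_ne_nil _ hne] at hs, hv⟩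
  exact ⟨hp, fun q hq hlt =>
    heff _ (hq.append_singleton hvu) (hInd v u hvu q p hq hp hlt)⟩

/-- An independent POSP instance is subpath optimal: every prefix of
an efficient path is efficient. -/
theorem independent_implies_subpathOptimal
    {V S : Type*} [Fintype V] [Nonempty V] [PartialOrder S]
    (A : V → V → Prop) (s : V) (W : List V → S)
    (hInd : Independent A s W) :
    ∀ (t : V) (p : List V), EfficientPath A s W t p → SubpathOptimalPath A s W p := by
  intro t p
  induction p using List.reverseRecOn generalizing t with
  | nil => intro _ i h; simp at h
  | append_singleton l u ih =>
    intro hp i hi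
    obtain rfl : u = t := by simpa using hp.1.2.2
    rcases Nat.lt_or_ge i l.length with hil | hil
    · have hl : l ≠ [] := by rintro rfl; simp at hil
      have hprefix := ih _ (hp.of_append_singleton hInd (List.getLast?_eq_some_getLast hl)) i hil
      rwa [List.getElem_append_left hil, List.take_append_of_le_length hil]
    · obtain rfl : i = l.length := by simp at hi; omega
      simpa [List.take_of_length_le] using hp
end

section
/- Let (G,W,S,⪯,s) be a POSP instance that is history-free, weakly independent and cycle-increasing. Then for every t ∈ V and every s,t-path p there exists a simple s,t-path q with W(q) ⪯ W(p). -/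
/-- History-freeness: extensions of equal-weight `s,v`-paths along the same arc out
of `v` have equal weight. -/
def HistoryFree {V S : Type*} (A : V → V → Prop) (s : V) (W : List V → S) : Prop :=
  ∀ v u : V, A v u → ∀ p q : List V, IsStPath A s v p → IsStPath A s v q →
    W p = W q → W (p ++ [u]) = W (q ++ [u])

/-- Weak independence: `W p ≺ W q` implies `W (p+a) ⪯ W (q+a)` for arcs `a` out of
the common endpoint. -/
def WeaklyIndependent {V S : Type*} [PartialOrder S] (A : V → V → Prop) (s : V)
    (W : List V → S) : Prop :=
  ∀ v u : V, A v u → ∀ p q : List V, IsStPath A s v p → IsStPath A s v q →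
    W p < W q → W (p ++ [u]) ≤ W (q ++ [u])

/-- Cycle-increasing: appending a cycle (a `v,v`-path of length ≥ 1, concatenated by
identifying the shared endpoint, i.e. `p ++ c.tail`) never decreases the weight. -/
def CycleIncreasing {V S : Type*} [PartialOrder S] (A : V → V → Prop) (s : V)
    (W : List V → S) : Prop :=
  ∀ v : V, ∀ p c : List V, IsStPath A s v p → IsStPath A v v c → 2 ≤ c.length →
    W p ≤ W (p ++ c.tail)

/-- Appending an arc out of the endpoint of a path gives a path. -/
theorem IsStPath.snoc {V : Type*} {A : V → V → Prop} {s v u : V} {p : List V}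
    (hp : IsStPath A s v p) (h : A v u) : IsStPath A s u (p ++ [u]) := by
  obtain ⟨⟨hne, hc⟩, hs, hv⟩ := hp
  refine ⟨⟨by simp, List.isChain_append.2 ⟨hc, List.isChain_singleton u, ?_⟩⟩, ?_, by simp⟩
  · simp_all
  · simp [List.head?_append, hs]

/-- In a history-free, weakly independent, cycle-increasing POSP
instance, every `s,t`-path is weakly dominated by a simple `s,t`-path. -/
theorem exists_simple_path_le
    {V S : Type*} [Fintype V] [Nonempty V] [PartialOrder S]
    (A : V → V → Prop) (s : V) (W : List V → S)
    (hHF : HistoryFree A s W) (hWI : WeaklyIndependent A s W)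
    (hCI : CycleIncreasing A s W) :
    ∀ (t : V) (p : List V), IsStPath A s t p →
      ∃ q : List V, IsStPath A s t q ∧ q.Nodup ∧ W q ≤ W p := by
  intro t p
  induction p using List.reverseRecOn generalizing t with
  | nil => exact fun h => absurd rfl h.1.1
  | append_singleton l u ih =>
    rintro ⟨⟨-, hc⟩, hs, ht⟩
    obtain rfl : u = t := by simpa using ht
    obtain rfl | hl := eq_or_ne l []
    · exact ⟨[u], ⟨⟨by simp, hc⟩, hs, ht⟩, by simp, le_rfl⟩
    obtain ⟨hcl, -, hlink⟩ := List.isChain_append.1 hc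
    have hlast : l.getLast? = some (l.getLast hl) := List.getLast?_eq_some_getLast hl
    have harc : A (l.getLast hl) u := hlink _ hlast _ rfl
    have hlp : IsStPath A s (l.getLast hl) l :=
      ⟨⟨hl, hcl⟩, by rwa [List.head?_append_of_ne_nil _ hl] at hs, hlast⟩
    obtain ⟨q, hq, hnd, hle⟩ := ih _ hlp
    have hext : W (q ++ [u]) ≤ W (l ++ [u]) := by
      rcases hle.eq_or_lt with heq | hlt
      · exact (hHF _ _ harc q l hq hlp heq).le
      · exact hWI _ _ harc q l hq hlp hlt
    have hqu := hq.snoc harc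
    by_cases hu : u ∈ q
    · obtain ⟨a, b, rfl⟩ := List.append_of_mem hu
      have hsplit : a ++ u :: b ++ [u] = (a ++ [u]) ++ (b ++ [u]) := by simp
      have hchain : (a ++ u :: (b ++ [u])).IsChain A := by
        have h : (a ++ u :: b ++ [u]).IsChain A := hqu.1.2
        simpa using h
      have hau : IsStPath A s u (a ++ [u]) := by
        refine ⟨⟨by simp, (List.isChain_split.1 hchain).1⟩, ?_, by simp⟩
        have := hq.2.1
        cases a <;> simpa using this
      have hcycle : IsStPath A u u (u :: (b ++ [u])) :=
        ⟨⟨by simp, (List.isChain_split.1 hchain).2⟩, rfl, by simp [List.getLast?_cons]⟩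
      refine ⟨a ++ [u], hau, ?_, ?_⟩
      · exact hnd.sublist (by simp)
      · refine le_trans ?_ hext
        rw [hsplit]
        exact hCI u _ _ hau hcycle (by simp)
    · refine ⟨q ++ [u], hqu, ?_, hext⟩
      simpa [List.nodup_append] using ⟨hnd, fun x hx hxu => hu (hxu ▸ hx)⟩
end

section
/- Let (G,W,S,⪯,s) be a POSP instance that is history-free, weakly independent and cycle-increasing. Then the instance is weakly subpath optimal; moreover, for every t ∈ V and every nondominated weight τ ∈ N_{s,t} there exists a simple s,t-path p with W(p) = τ. -/
/-- The nondominated set `N_{s,t}`: weights of efficient `s,t`-paths. -/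
def NondomSet {V S : Type*} [PartialOrder S] (A : V → V → Prop) (s : V)
    (W : List V → S) (t : V) : Set S :=
  {τ | ∃ p : List V, EfficientPath A s W t p ∧ W p = τ}

/-- Weak subpath optimality of the instance: every efficient `s,t`-path has an
equal-weight `s,t`-path all of whose prefixes are efficient. -/
def WeaklySubpathOptimal {V S : Type*} [PartialOrder S] (A : V → V → Prop) (s : V)
    (W : List V → S) : Prop :=
  ∀ (t : V) (p : List V), EfficientPath A s W t p →
    ∃ q : List V, IsStPath A s t q ∧ W q = W p ∧ SubpathOptimalPath A s W q

section

variable {V S : Type*} {A : V → V → Prop} {s v u : V} {p q r : List V}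

theorem IsStPath.append (hp : IsStPath A s v p) (hr : (v :: r).IsChain A)
    (hu : (v :: r).getLast? = some u) : IsStPath A s u (p ++ r) := by
  obtain ⟨⟨hne, hc⟩, hs, ht⟩ := hp
  obtain ⟨p, rfl⟩ := List.getLast?_eq_some_iff.1 ht
  have h : p ++ [v] ++ r = p ++ v :: r := by simp
  refine ⟨⟨by simp, ?_⟩, ?_, ?_⟩
  · show List.IsChain A (p ++ [v] ++ r)
    rw [h]
    exact List.isChain_split.2 ⟨hc, hr⟩
  · rw [List.head?_append, hs]; rfl
  · rw [h, List.getLast?_append, hu]; rfl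

theorem IsStPath.concat (hp : IsStPath A s v p) (hvu : A v u) : IsStPath A s u (p ++ [u]) :=
  hp.append (by simpa using hvu) (by simp)

/-- If the path `p` extends to a path `p ++ r`, then `r` continues the endpoint of `p` by arcs. -/
theorem IsStPath.isChain_right (hp : IsStPath A s v p) (h : IsStPath A s u (p ++ r)) :
    (v :: r).IsChain A := by
  obtain ⟨p, rfl⟩ := List.getLast?_eq_some_iff.1 hp.2.2
  have hc : List.IsChain A (p ++ [v] ++ r) := h.1.2
  rw [List.append_assoc] at hc
  exact (List.isChain_append.1 hc).2.1

theorem IsStPath.getLast?_right (hp : IsStPath A s v p) (h : IsStPath A s u (p ++ r)) :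
    (v :: r).getLast? = some u := by
  obtain ⟨p, rfl⟩ := List.getLast?_eq_some_iff.1 hp.2.2
  simpa using h.2.2

theorem IsStPath.left (h : IsStPath A s u (p ++ [v] ++ r)) : IsStPath A s v (p ++ [v]) := by
  obtain ⟨⟨-, hc⟩, hs, -⟩ := h
  refine ⟨⟨by simp, (List.isChain_append.1 hc).1⟩, ?_, by simp⟩
  rw [List.head?_append] at hs
  cases p <;> simpa using hs

theorem IsStPath.eq_singleton_or_concat (h : IsStPath A s v p) :
    (p = [s] ∧ v = s) ∨ ∃ p' w, p = p' ++ [v] ∧ A w v ∧ IsStPath A s w p' := by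
  obtain ⟨p, rfl⟩ := List.getLast?_eq_some_iff.1 h.2.2
  rcases List.eq_nil_or_concat p with rfl | ⟨p, w, rfl⟩
  · left
    simpa using h.2.1
  · right
    rw [List.concat_eq_append] at h ⊢
    refine ⟨p ++ [w], w, rfl, ?_, IsStPath.left h⟩
    simpa using (IsStPath.left h).isChain_right h

variable [PartialOrder S] {W : List V → S}

/-- History-freeness and weak independence make appending an arc monotone. -/
theorem le_concat (hHF : HistoryFree A s W) (hWI : WeaklyIndependent A s W) (hvu : A v u)
    (hp : IsStPath A s v p) (hq : IsStPath A s v q) (h : W p ≤ W q) :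
    W (p ++ [u]) ≤ W (q ++ [u]) := by
  rcases h.eq_or_lt with h | h
  · exact (hHF v u hvu p q hp hq h).le
  · exact hWI v u hvu p q hp hq h

theorem le_append (hHF : HistoryFree A s W) (hWI : WeaklyIndependent A s W)
    (hp : IsStPath A s v p) (hq : IsStPath A s v q) (hr : (v :: r).IsChain A)
    (h : W p ≤ W q) : W (p ++ r) ≤ W (q ++ r) := by
  induction r generalizing v p q with
  | nil => simpa using h
  | cons u r ih =>
    obtain ⟨hvu, hr⟩ := List.isChain_cons_cons.1 hr
    simpa using ih (hp.concat hvu) (hq.concat hvu) hr (le_concat hHF hWI hvu hp hq h)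

/-- Extending a path by a closed walk at its endpoint does not decrease the weight. -/
theorem le_of_return (hCI : CycleIncreasing A s W) (hp : IsStPath A s v p)
    (h : IsStPath A s v (p ++ r)) : W p ≤ W (p ++ r) := by
  cases r with
  | nil => simp
  | cons w r =>
    exact hCI v p (v :: w :: r) hp
      ⟨⟨by simp, hp.isChain_right h⟩, rfl, hp.getLast?_right h⟩ (by simp)

theorem exists_nodup_le (hHF : HistoryFree A s W) (hWI : WeaklyIndependent A s W)
    (hCI : CycleIncreasing A s W) (hp : IsStPath A s v p) :
    ∃ q, IsStPath A s v q ∧ q.Nodup ∧ W q ≤ W p := by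
  induction hn : p.length generalizing p v with
  | zero => exact absurd (List.length_eq_zero_iff.1 hn) hp.1.1
  | succ n ih =>
    rcases hp.eq_singleton_or_concat with ⟨rfl, rfl⟩ | ⟨p, w, rfl, hwv, hp'⟩
    · exact ⟨_, hp, by simp, le_rfl⟩
    · obtain ⟨q, hq, hnd, hle⟩ := ih hp' (by simpa using hn)
      have hle := le_concat hHF hWI hwv hq hp' hle
      by_cases hv : v ∈ q
      · obtain ⟨a, b, rfl⟩ := List.append_of_mem hv
        have hab : a ++ v :: b ++ [v] = a ++ [v] ++ (b ++ [v]) := by simp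
        have hqv := hq.concat hwv
        rw [hab] at hqv hle
        exact ⟨a ++ [v], hqv.left, hnd.sublist (by simp),
          (le_of_return hCI hqv.left hqv).trans hle⟩
      · exact ⟨q ++ [v], hq.concat hwv, List.concat_eq_append ▸ hnd.concat hv, hle⟩

theorem exists_efficientPath_le [Finite V] (hHF : HistoryFree A s W)
    (hWI : WeaklyIndependent A s W) (hCI : CycleIncreasing A s W) (hp : IsStPath A s v p) :
    ∃ q, EfficientPath A s W v q ∧ W q ≤ W p := by
  classical
  have := Fintype.ofFinite V
  have hfin : {q : List V | IsStPath A s v q ∧ q.Nodup ∧ W q ≤ W p}.Finite :=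
    (List.finite_length_le V (Fintype.card V)).subset fun q hq => hq.2.1.length_le_card
  obtain ⟨q, hq, hmin⟩ := hfin.exists_minimalFor W _ (exists_nodup_le hHF hWI hCI hp)
  refine ⟨q, ⟨hq.1, fun q₁ hq₁ hlt => ?_⟩, hq.2.2⟩
  obtain ⟨q₂, hq₂, hnd, hle⟩ := exists_nodup_le hHF hWI hCI hq₁
  have hlt := hle.trans_lt hlt
  exact hlt.not_ge (hmin ⟨hq₂, hnd, hlt.le.trans hq.2.2⟩ hlt.le)

theorem EfficientPath.eq_of_le (hp : EfficientPath A s W v p) (hq : IsStPath A s v q)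
    (h : W q ≤ W p) : W q = W p :=
  h.eq_of_not_lt (hp.2 q hq)

theorem EfficientPath.of_le (hp : EfficientPath A s W v p) (hq : IsStPath A s v q)
    (h : W q ≤ W p) : EfficientPath A s W v q :=
  ⟨hq, hp.eq_of_le hq h ▸ hp.2⟩

theorem subpathOptimalPath_of_prefix
    (h : ∀ q, q ≠ [] → q <+: p → ∃ v, EfficientPath A s W v q) :
    SubpathOptimalPath A s W p := by
  intro i hi
  obtain ⟨v, hv⟩ := h (p.take (i + 1)) (by simpa using List.ne_nil_of_length_pos (by omega))
    (List.take_prefix _ _)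
  have hlast := hv.1.2.2
  rw [List.take_add_one, List.getElem?_eq_getElem hi] at hlast
  simp only [Option.toList_some, List.getLast?_append, List.getLast?_singleton,
    Option.some_or, Option.some.injEq] at hlast
  exact hlast ▸ hv

open Classical in
/-- If all prefixes of `q ++ r` from `q` onwards are efficient, the earlier ones can be made
efficient too. Each replacement of an inefficient prefix adds a new vertex to `r`, because
`W` is cycle-increasing. -/
theorem exists_subpathOptimalPath [Finite V] {v : V} {q r : List V} (hHF : HistoryFree A s W)
    (hWI : WeaklyIndependent A s W) (hCI : CycleIncreasing A s W)
    (hq : IsStPath A s v q) (hqr : IsStPath A s u (q ++ r))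
    (heff : ∀ r', r' <+: r → ∃ x, EfficientPath A s W x (q ++ r')) :
    ∃ p, IsStPath A s u p ∧ W p = W (q ++ r) ∧ SubpathOptimalPath A s W p := by
  rcases hq.eq_singleton_or_concat with ⟨rfl, rfl⟩ | ⟨q₀, w, hq_eq, hwv, hq₀⟩
  · refine ⟨_, hqr, rfl, subpathOptimalPath_of_prefix fun q hne hpre => ?_⟩
    rw [List.singleton_append, List.prefix_cons_iff] at hpre
    obtain rfl | ⟨r', rfl, hr'⟩ := hpre
    · exact absurd rfl hne
    · exact heff r' hr'
  · have happ (r' : List V) : q ++ r' = q₀ ++ v :: r' := by simp [hq_eq]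
    simp only [happ] at heff hqr ⊢
    by_cases hopt : EfficientPath A s W w q₀
    · refine exists_subpathOptimalPath hHF hWI hCI hq₀ hqr fun r₁ hr₁ => ?_
      obtain rfl | ⟨r', rfl, hr'⟩ := List.prefix_cons_iff.1 hr₁
      · exact ⟨w, by simpa using hopt⟩
      · exact heff r' hr'
    · have hw : w ∉ v :: r := by
        refine fun hw => hopt ⟨hq₀, fun q₁ hq₁ hlt => ?_⟩
        obtain ⟨b, d, hbd⟩ := List.append_of_mem hw
        have hret : ∃ x, EfficientPath A s W x (q₀ ++ (b ++ [w])) := by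
          cases b with
          | nil =>
            obtain ⟨rfl, -⟩ := List.cons.inj hbd
            exact heff [] List.nil_prefix
          | cons y b =>
            obtain ⟨rfl, rfl⟩ := List.cons.inj hbd
            exact heff (b ++ [w]) ⟨d, by simp⟩
        obtain ⟨x, hx⟩ := hret
        obtain rfl : w = x := by simpa using hx.1.2.2
        exact hx.2 q₁ hq₁ (hlt.trans_le (le_of_return hCI hq₀ hx.1))
      obtain ⟨q₁, hq₁, hle⟩ := exists_efficientPath_le hHF hWI hCI hq₀
      have hch := hq₀.isChain_right hqr
      have hext := hq₁.1.append hch (hq₀.getLast?_right hqr)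
      obtain ⟨x, hx⟩ := heff r (List.prefix_refl r)
      obtain ⟨p, hp, hpW, hps⟩ := exists_subpathOptimalPath hHF hWI hCI hq₁.1 hext
        fun r₁ hr₁ => by
          obtain rfl | ⟨r', rfl, hr'⟩ := List.prefix_cons_iff.1 hr₁
          · exact ⟨w, by simpa using hq₁⟩
          · obtain ⟨x, hx⟩ := heff r' hr'
            exact ⟨x, hx.of_le (hq₁.1.append (hq₀.isChain_right hx.1)
              (hq₀.getLast?_right hx.1))
              (le_append hHF hWI hq₁.1 hq₀ (hq₀.isChain_right hx.1) hle)⟩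
      obtain rfl : x = u := by simpa [hx.1.2.2] using hqr.2.2
      exact ⟨p, hp, hpW.trans (hx.eq_of_le hext (le_append hHF hWI hq₁.1 hq₀ hch hle)), hps⟩
termination_by (Nat.card V - (v :: r).toFinset.card, q.length)
decreasing_by
  · simp only [List.toFinset_cons, Prod.lex_def, hq_eq]
    have h := Finset.card_le_card (Finset.subset_insert w (insert v r.toFinset))
    simp only [List.length_append, List.length_singleton]
    omega
  · have := Fintype.ofFinite V
    simp only [List.toFinset_cons, Prod.lex_def]
    have h := Finset.card_insert_of_notMem (show w ∉ insert v r.toFinset by simpa using hw)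
    have h' := Finset.card_le_univ (insert w (insert v r.toFinset))
    rw [Nat.card_eq_fintype_card]
    omega

end

/-- A history-free, weakly independent, cycle-increasing POSP
instance is weakly subpath optimal, and every nondominated weight is attained by a
simple path. -/
theorem hf_wi_ci_implies_wso_and_simple
    {V S : Type*} [Fintype V] [Nonempty V] [PartialOrder S]
    (A : V → V → Prop) (s : V) (W : List V → S)
    (hHF : HistoryFree A s W) (hWI : WeaklyIndependent A s W)
    (hCI : CycleIncreasing A s W) :
    WeaklySubpathOptimal A s W ∧
    ∀ (t : V) (τ : S), τ ∈ NondomSet A s W t →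
      ∃ p : List V, IsStPath A s t p ∧ p.Nodup ∧ W p = τ := by
  refine ⟨fun t p hp => ?_, ?_⟩
  · simpa using exists_subpathOptimalPath (r := []) hHF hWI hCI hp.1 (by simpa using hp.1)
      fun r' hr' => ⟨t, by simpa [List.prefix_nil.1 hr'] using hp⟩
  · rintro t τ ⟨p, hp, rfl⟩
    obtain ⟨q, hq, hnd, hle⟩ := exists_nodup_le hHF hWI hCI hp.1
    exact ⟨q, hq, hnd, hp.eq_of_le hq hle⟩
end

section
/- There exists a POSP instance (G,W,S,⪯,s) that is well-posed, history-free and weakly independent, but NOT weakly subpath optimal. (For instance, the digraph with V = {v₁,v₂}, arcs (v₁,v₂) and (v₂,v₂), source s = v₁, weight space S = ℕ with its usual order, and weights W((v₁,v₂)) = 2 and W(p) = 1 for every v₁,v₂-path p of length ≥ 2, is such an instance.) -/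
/-- Well-posedness: the set of all nondominated weights is finite, and every
nonempty chain of path weights contains a minimum element. -/
def WellPosed {V S : Type*} [PartialOrder S] (A : V → V → Prop) (s : V)
    (W : List V → S) : Prop :=
  (⋃ v : V, NondomSet A s W v).Finite ∧
  ∀ C : Set S,
    C ⊆ {τ | ∃ p : List V, IsPath A p ∧ p.head? = some s ∧ W p = τ} →
    IsChain (· ≤ ·) C → C.Nonempty → ∃ m ∈ C, ∀ x ∈ C, m ≤ x

/-- The arc relation on `Bool` in which every arc enters `true`. -/
def arcToTrue (_ v : Bool) : Prop := v = true

/-- The weight that is `2` on paths with exactly one arc and `1` on all other paths. -/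
def singleArcWeight (p : List Bool) : ℕ := if p.length = 2 then 2 else 1

lemma length_eq_one_iff_of_isStPath {v : Bool} {p : List Bool}
    (h : IsStPath arcToTrue false v p) : p.length = 1 ↔ v = false := by
  obtain ⟨⟨-, hc⟩, hs, ht⟩ := h
  induction p using List.reverseRecOn with
  | nil => simp at hs
  | append_singleton l x _ =>
    rcases l.eq_nil_or_concat with rfl | ⟨l, y, rfl⟩
    · simp_all
    · have hx : arcToTrue y x := by
        rw [List.concat_eq_append, List.append_assoc] at hc
        exact (List.isChain_append.1 hc).2.1.rel
      have hxv : x = v := by simpa using ht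
      have hx' : x = true := hx
      simp [← hxv, hx']

lemma singleArcWeight_append_singleton {v : Bool} {p : List Bool}
    (h : IsStPath arcToTrue false v p) (u : Bool) :
    singleArcWeight (p ++ [u]) = if v = false then 2 else 1 := by
  simp [singleArcWeight, length_eq_one_iff_of_isStPath h]

lemma singleArcWeight_eq_one_or_two (p : List Bool) :
    singleArcWeight p = 1 ∨ singleArcWeight p = 2 := by
  unfold singleArcWeight
  split_ifs <;> simp

/-- There is a POSP instance that is well-posed, history-free and
weakly independent but not weakly subpath optimal. -/
theorem exists_wp_hf_wi_not_wso :
    ∃ (V : Type) (_ : Fintype V) (_ : Nonempty V) (A : V → V → Prop)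
      (S : Type) (instS : PartialOrder S) (s : V) (W : List V → S),
      @WellPosed V S instS A s W ∧
      HistoryFree A s W ∧
      @WeaklyIndependent V S instS A s W ∧
      ¬ @WeaklySubpathOptimal V S instS A s W := by
  refine ⟨Bool, inferInstance, inferInstance, arcToTrue, ℕ, inferInstance, false,
    singleArcWeight, ⟨?_, ?_⟩, ?_, ?_, ?_⟩
  · refine (Set.toFinite {1, 2}).subset (Set.iUnion_subset ?_)
    rintro v _ ⟨p, -, rfl⟩
    exact singleArcWeight_eq_one_or_two p
  · intro C _ _ hC
    exact ⟨sInf C, Nat.sInf_mem hC, fun x hx => Nat.sInf_le hx⟩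
  · intro v u _ p q hp hq _
    rw [singleArcWeight_append_singleton hp, singleArcWeight_append_singleton hq]
  · intro v u _ p q hp hq _
    rw [singleArcWeight_append_singleton hp, singleArcWeight_append_singleton hq]
  · intro hopt
    have hloop : IsStPath arcToTrue false true [false, true, true] := by
      refine ⟨⟨by simp, ?_⟩, by simp, by simp⟩
      change List.IsChain _ _
      simp [arcToTrue]
    have hw : singleArcWeight [false, true, true] = 1 := rfl
    obtain ⟨q, hq, hWq, hsub⟩ := hopt true _ ⟨hloop, fun r _ hr => by
      rcases singleArcWeight_eq_one_or_two r with h | h <;> omega⟩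
    have hlen : 1 < q.length := by
      have h1 : q.length ≠ 1 := by simp [length_eq_one_iff_of_isStPath hq]
      have h0 := List.length_pos_iff.2 hq.1.1
      omega
    obtain ⟨hpre, hmin⟩ := hsub 1 hlen
    have htake : (q.take (1 + 1)).length = 2 := by
      rw [List.length_take]
      omega
    have hend : q[1] = true := by
      rw [← Bool.not_eq_false, ← length_eq_one_iff_of_isStPath hpre, htake]
      decide
    refine hmin [false, true, true] (by rwa [hend]) ?_
    rw [hw, singleArcWeight, if_pos htake]
    decide
end

section
/- Let (G,W₁,S₁,⪯₁,s) and (G,W₂,S₂,⪯₂,s) be two POSP instances on the same digraph G = (V,A) with the same source s, and consider the product instance (G, W₁ΔW₂, S₁×S₂, ⪯, s), where (W₁ΔW₂)(p) = (W₁(p),W₂(p)) and (x₁,x₂) ⪯ (y₁,y₂) :⟺ x₁ ⪯₁ y₁ and x₂ ⪯₂ y₂. If both instances are history-free, weakly independent and arc-increasing, then the product instance is history-free, weakly independent and arc-increasing. -/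
/-- Arc-increasing: appending an arc never decreases the weight. -/
def ArcIncreasing {V S : Type*} [PartialOrder S] (A : V → V → Prop) (s : V)
    (W : List V → S) : Prop :=
  ∀ v u : V, A v u → ∀ p : List V, IsStPath A s v p → W p ≤ W (p ++ [u])

/-- The product of two history-free, weakly independent and
arc-increasing POSP instances (with the product order on `S₁ × S₂`) is again
history-free, weakly independent and arc-increasing. -/
theorem product_instance_AHW
    {V S₁ S₂ : Type*} [Fintype V] [Nonempty V] [PartialOrder S₁] [PartialOrder S₂]
    (A : V → V → Prop) (s : V) (W₁ : List V → S₁) (W₂ : List V → S₂)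
    (hHF₁ : HistoryFree A s W₁) (hWI₁ : WeaklyIndependent A s W₁)
    (hAI₁ : ArcIncreasing A s W₁)
    (hHF₂ : HistoryFree A s W₂) (hWI₂ : WeaklyIndependent A s W₂)
    (hAI₂ : ArcIncreasing A s W₂) :
    HistoryFree A s (fun p => (W₁ p, W₂ p)) ∧
    WeaklyIndependent A s (fun p => (W₁ p, W₂ p)) ∧
    ArcIncreasing A s (fun p => (W₁ p, W₂ p)) := by
  refine ⟨fun v u hvu p q hp hq h => ?_, fun v u hvu p q hp hq h => ?_,
    fun v u hvu p hp => ⟨hAI₁ v u hvu p hp, hAI₂ v u hvu p hp⟩⟩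
  · obtain ⟨h₁, h₂⟩ := Prod.mk.inj h
    exact Prod.ext (hHF₁ v u hvu p q hp hq h₁) (hHF₂ v u hvu p q hp hq h₂)
  · exact ⟨h.le.1.eq_or_lt.elim (fun e => (hHF₁ v u hvu p q hp hq e).le)
        (hWI₁ v u hvu p q hp hq),
      h.le.2.eq_or_lt.elim (fun e => (hHF₂ v u hvu p q hp hq e).le)
        (hWI₂ v u hvu p q hp hq)⟩
end

section
/- Let (G,W,ℝᵈ,≤,s) be a d-dimensional MOSP instance: W(p) = Σ_{i=1}^{n−1} X(vᵢ,vᵢ₊₁) for every path p = (v₁,…,vₙ) ∈ P_s, where X assigns to each arc a vector in ℝᵈ, and ≤ is the componentwise order on ℝᵈ. Suppose there exist a vertex v ∈ V, an s,v-path, a cycle c at v, and an index i ∈ {1,…,d} such that the i-th component of the total weight Σ X over the arcs of c is strictly negative. Then the instance is not well-posed: either ⋃_{u ∈ V} N_{s,u} is infinite, or some chain in W(P_s) has no minimum element. -/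
/-- The additive MOSP weight of a path: the sum of the arc weight vectors `X` over
the consecutive pairs of vertices (the single-vertex path has weight `0`). -/
def mospWeight {V : Type*} {d : ℕ} (X : V → V → (Fin d → ℝ)) : List V → (Fin d → ℝ)
  | [] => 0
  | [_] => 0
  | u :: v :: rest => X u v + mospWeight X (v :: rest)

theorem isStPath_append_tail {V : Type*} {A : V → V → Prop} {v w : V} {c : List V}
    (hc : IsStPath A v w (v :: c)) :
    ∀ {s : V} {p : List V}, IsStPath A s v p → IsStPath A s w (p ++ c)
  | _, [], hp => absurd rfl hp.1.1
  | s, [a], hp => by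
    obtain ⟨-, h₁, h₂⟩ := hp
    simp only [List.head?_cons, Option.some.injEq, List.getLast?_singleton] at h₁ h₂
    subst h₁ h₂
    exact hc
  | s, a :: b :: l, hp => by
    obtain ⟨⟨-, hch⟩, h₁, h₂⟩ := hp
    have hch' := List.isChain_cons_cons.1 hch
    have ih := isStPath_append_tail hc (s := b) (p := b :: l)
      ⟨⟨List.cons_ne_nil _ _, hch'.2⟩, rfl, by rwa [List.getLast?_cons_cons] at h₂⟩
    refine ⟨⟨List.cons_ne_nil _ _, List.isChain_cons_cons.2 ⟨hch'.1, ih.1.2⟩⟩, h₁, ?_⟩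
    have h₃ := ih.2.2
    simp only [List.cons_append] at h₃ ⊢
    rwa [List.getLast?_cons_cons]

theorem mospWeight_append_tail {V : Type*} {d : ℕ} (X : V → V → (Fin d → ℝ)) {v : V}
    (c : List V) :
    ∀ {p : List V}, p.getLast? = some v →
      mospWeight X (p ++ c) = mospWeight X p + mospWeight X (v :: c)
  | [], h => by simp at h
  | [a], h => by
    simp only [List.getLast?_singleton, Option.some.injEq] at h
    subst h
    simp [mospWeight]
  | a :: b :: l, h => by
    have ih := mospWeight_append_tail X c (p := b :: l)
      (by rwa [List.getLast?_cons_cons] at h)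
    simp only [List.cons_append, mospWeight] at ih ⊢
    rw [ih, add_assoc]

/-- In a well-posed instance, every path is dominated by an efficient path with the same
endpoint. -/
theorem WellPosed.exists_efficientPath_le {V S : Type*} [PartialOrder S] {A : V → V → Prop}
    {s : V} {W : List V → S} (h : WellPosed A s W) {t : V} {p : List V}
    (hp : IsStPath A s t p) : ∃ q, EfficientPath A s W t q ∧ W q ≤ W p := by
  obtain ⟨m, hm, ⟨q, hq, rfl⟩, hmin⟩ := zorn_le_nonempty₀ (α := Sᵒᵈ)
    {τ | ∃ q, IsStPath A s t q ∧ OrderDual.toDual (W q) = τ}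
    (fun C hC hchain y hy => by
      obtain ⟨m, hm, hle⟩ := h.2 (OrderDual.toDual ⁻¹' C)
        (fun τ hτ => by
          obtain ⟨q, hq, hqτ⟩ := hC hτ
          exact ⟨q, hq.1, hq.2.1, OrderDual.toDual.injective hqτ⟩)
        (fun a ha b hb hab => (hchain ha hb hab).symm) ⟨OrderDual.ofDual y, hy⟩
      exact ⟨OrderDual.toDual m, hC hm, fun z hz => hle (OrderDual.ofDual z) hz⟩)
    (OrderDual.toDual (W p)) ⟨p, hp, rfl⟩
  exact ⟨q, ⟨hq, fun r hr hlt => hlt.not_ge (hmin ⟨r, hr, rfl⟩ hlt.le)⟩, hm⟩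

/-- A MOSP instance that has a cycle, reachable from the source,
whose total weight is strictly negative in some component, is not well-posed. -/
theorem mosp_negative_cycle_not_wellPosed
    {V : Type*} [Fintype V] [Nonempty V] {d : ℕ}
    (A : V → V → Prop) (s : V) (X : V → V → (Fin d → ℝ))
    (hcyc : ∃ v : V, (∃ p : List V, IsStPath A s v p) ∧
      ∃ c : List V, IsStPath A v v c ∧ 2 ≤ c.length ∧
        ∃ i : Fin d, mospWeight X c i < 0) :
    ¬ WellPosed A s (mospWeight X) := by
  rintro hwp
  obtain ⟨v, ⟨p, hp⟩, c, hc, -, i, hi⟩ := hcyc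
  obtain ⟨c', rfl⟩ : ∃ c', c = v :: c' := List.head?_eq_some_iff.1 hc.2.1
  have hfin : (NondomSet A s (mospWeight X) v).Finite :=
    hwp.1.subset (Set.subset_iUnion _ v)
  obtain ⟨q₀, hq₀, -⟩ := hwp.exists_efficientPath_le hp
  obtain ⟨_, ⟨q, hq, rfl⟩, hmin⟩ :=
    Set.exists_min_image _ (fun τ => τ i) hfin ⟨_, q₀, hq₀, rfl⟩
  obtain ⟨r, hr, hle⟩ := hwp.exists_efficientPath_le (isStPath_append_tail hc hq.1)
  have h₁ := hmin _ ⟨r, hr, rfl⟩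
  have h₂ := hle i
  rw [mospWeight_append_tail X c' hq.1.2.2, Pi.add_apply] at h₂
  linarith
end

section
/- Let (G,W,S,⪯,s) be a POSP instance that is well-posed, weakly independent and history-free with arc update function U : S × A → S (i.e., W(p+a) = U(W(p),a) for every path p ∈ P_s ending at some v and every arc a out of v). Define sets D_{v,k} ⊆ S by D_{s,0} = {W((s))}, D_{v,0} = ∅ for v ≠ s, and D_{v,k} = Min(D_{v,k−1} ∪ {U(τ,(u,v)) : (u,v) ∈ A, τ ∈ D_{u,k−1}}) for k ≥ 1, where Min(T) := {τ ∈ T : there is no σ ∈ T with σ ≺ τ}. Then there exists K ∈ ℕ such that for all k ≥ K and all v ∈ V, D_{v,k} = N_{s,v}. (Correctness of the Bellman–Ford-type label-correcting algorithm for POSP at the level of weight sets.) -/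
/-- `Min(T)`: the elements of `T` not strictly dominated by any element of `T`. -/
def MinSet {S : Type*} [PartialOrder S] (T : Set S) : Set S :=
  {τ | τ ∈ T ∧ ¬ ∃ σ ∈ T, σ < τ}

/-- Extending an `s,u`-path by an arc out of `u`. -/
lemma IsStPath.append_s16 {V : Type*} {A : V → V → Prop} {s u v : V} {p : List V}
    (hp : IsStPath A s u p) (h : A u v) : IsStPath A s v (p ++ [v]) := by
  obtain ⟨⟨hne, hc⟩, hs, hu⟩ := hp
  refine ⟨⟨by simp, ?_⟩, ?_, by simp⟩
  · refine List.isChain_append.2 ⟨hc, by simp, ?_⟩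
    intro x hx y hy
    simp_all
  · simp [List.head?_append, hs]

/-- Induction on paths starting at `s`, one arc at a time. -/
lemma IsStPath.rec_append {V : Type*} {A : V → V → Prop} {s : V} {P : V → List V → Prop}
    (base : P s [s])
    (step : ∀ u v p, IsStPath A s u p → A u v → P u p → P v (p ++ [v]))
    {v : V} {p : List V} (hp : IsStPath A s v p) : P v p := by
  induction p using List.reverseRecOn generalizing v with
  | nil => exact absurd rfl hp.1.1
  | append_singleton p x ih =>
    obtain ⟨⟨-, hc⟩, hs, hv⟩ := hp
    obtain rfl : x = v := by simpa using hv
    rcases List.eq_nil_or_concat' p with rfl | ⟨q, u, rfl⟩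
    · obtain rfl : x = s := by simpa using hs
      exact base
    · obtain ⟨hq, -, hadj⟩ := List.isChain_append.1 hc
      have hpath : IsStPath A s u (q ++ [u]) := by
        refine ⟨⟨by simp, hq⟩, ?_, by simp⟩
        rw [List.head?_append_of_ne_nil _ (by simp)] at hs
        exact hs
      exact step u x _ hpath (hadj u (by simp) x (by simp)) (ih hpath)

/-- In a well-posed instance the set of path weights is well-founded. -/
lemma WellPosed.isWF {V S : Type*} [PartialOrder S] {A : V → V → Prop} {s : V}
    {W : List V → S} (h : WellPosed A s W) :
    {τ | ∃ p : List V, IsPath A p ∧ p.head? = some s ∧ W p = τ}.IsWF := by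
  rw [Set.isWF_iff_no_descending_seq]
  intro f hf hmem
  obtain ⟨_, ⟨n, rfl⟩, hn⟩ := h.2 (Set.range f) (Set.range_subset_iff.2 hmem)
    hf.antitone.isChain_range (Set.range_nonempty f)
  exact (hf n.lt_succ_self).not_ge (hn _ ⟨n + 1, rfl⟩)

/-- Every element of a well-founded set lies above a minimal one. -/
lemma Set.IsWF.exists_mem_minSet_le {S : Type*} [PartialOrder S] {T : Set S} (hT : T.IsWF)
    {x : S} (hx : x ∈ T) : ∃ y ∈ MinSet T, y ≤ x := by
  have hwf : {y ∈ T | y ≤ x}.IsWF := hT.mono (Set.sep_subset _ _)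
  have hne : {y ∈ T | y ≤ x}.Nonempty := ⟨x, hx, le_rfl⟩
  obtain ⟨hm, hle⟩ := hwf.min_mem hne
  refine ⟨hwf.min hne, ⟨hm, ?_⟩, hle⟩
  rintro ⟨σ, hσ, hlt⟩
  exact hwf.not_lt_min hne ⟨hσ, hlt.le.trans hle⟩ hlt

/-- The nondominated set consists of the minimal weights of `s,v`-paths. -/
lemma nondomSet_eq_minSet {V S : Type*} [PartialOrder S] (A : V → V → Prop) (s : V)
    (W : List V → S) (v : V) :
    NondomSet A s W v = MinSet (W '' {p | IsStPath A s v p}) := by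
  ext τ
  constructor
  · rintro ⟨p, ⟨hp, hmin⟩, rfl⟩
    refine ⟨⟨p, hp, rfl⟩, ?_⟩
    rintro ⟨_, ⟨q, hq, rfl⟩, hlt⟩
    exact hmin q hq hlt
  · rintro ⟨⟨p, hp, rfl⟩, hmin⟩
    exact ⟨p, ⟨hp, fun q hq hlt => hmin ⟨_, ⟨q, hq, rfl⟩, hlt⟩⟩, rfl⟩

/-- Correctness of the Bellman–Ford-type label-correcting algorithm
for well-posed, history-free (with arc update function `U`) and weakly independent
POSP instances, at the level of weight sets: the iterates `D k v` eventually equal the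
nondominated sets `N_{s,v}`. -/
theorem bellmanFord_correct_weaklyIndependent
    {V S : Type*} [Fintype V] [Nonempty V] [PartialOrder S]
    (A : V → V → Prop) (s : V) (W : List V → S)
    (hWP : WellPosed A s W) (hWI : WeaklyIndependent A s W)
    (U : S → V → V → S)
    (hU : ∀ v u : V, A v u → ∀ p : List V, IsStPath A s v p →
      W (p ++ [u]) = U (W p) v u)
    (D : ℕ → V → Set S)
    (hD0s : D 0 s = {W [s]})
    (hD0 : ∀ v : V, v ≠ s → D 0 v = ∅)
    (hDk : ∀ (k : ℕ) (v : V),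
      D (k + 1) v =
        MinSet (D k v ∪ {σ | ∃ u : V, A u v ∧ ∃ τ ∈ D k u, σ = U τ u v})) :
    ∃ K : ℕ, ∀ k ≥ K, ∀ v : V, D k v = NondomSet A s W v := by
  have hweights : ∀ k v, D k v ⊆ W '' {p | IsStPath A s v p} := by
    intro k
    induction k with
    | zero =>
      intro v
      by_cases hv : v = s
      · subst hv
        rw [hD0s, Set.singleton_subset_iff]
        exact ⟨[v], ⟨⟨by simp, List.isChain_singleton v⟩, rfl, rfl⟩, rfl⟩
      · simp [hD0 v hv]
    | succ k ih =>
      intro v τ hτ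
      rw [hDk] at hτ
      obtain ⟨h | ⟨u, hA, σ, hσ, rfl⟩, -⟩ := hτ
      · exact ih v h
      · obtain ⟨p, hp, rfl⟩ := ih u hσ
        exact ⟨p ++ [v], hp.append_s16 hA, hU u v hA p hp⟩
  have hwf : ∀ v, (W '' {p | IsStPath A s v p}).IsWF := by
    refine fun v => hWP.isWF.mono ?_
    rintro _ ⟨p, hp, rfl⟩
    exact ⟨p, hp.1, hp.2.1, rfl⟩
  have hstep : ∀ k v, ∀ x ∈ D k v ∪ {σ | ∃ u : V, A u v ∧ ∃ τ ∈ D k u, σ = U τ u v},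
      ∃ y ∈ D (k + 1) v, y ≤ x := by
    intro k v x hx
    rw [hDk]
    refine ((hwf v).mono (Set.union_subset (hweights k v) ?_)).exists_mem_minSet_le hx
    rintro _ ⟨u, hA, σ, hσ, rfl⟩
    obtain ⟨p, hp, rfl⟩ := hweights k u hσ
    exact ⟨p ++ [v], hp.append_s16 hA, hU u v hA p hp⟩
  have hmono : ∀ v x j, (∃ y ∈ D j v, y ≤ x) → ∀ k ≥ j, ∃ y ∈ D k v, y ≤ x := by
    intro v x j hj k hk
    induction k, hk using Nat.le_induction with
    | base => exact hj
    | succ k _ ih =>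
      obtain ⟨y, hy, hyx⟩ := ih
      obtain ⟨z, hz, hzy⟩ := hstep k v y (Or.inl hy)
      exact ⟨z, hz, hzy.trans hyx⟩
  have hpath : ∀ v p, IsStPath A s v p → ∃ j, ∃ y ∈ D j v, y ≤ W p := by
    intro v p hp
    refine hp.rec_append (P := fun v p => ∃ j, ∃ y ∈ D j v, y ≤ W p)
      ⟨0, W [s], by simp [hD0s], le_rfl⟩ ?_
    rintro u v p hp hA ⟨j, y, hy, hle⟩
    obtain ⟨q, hq, rfl⟩ := hweights j u hy
    obtain ⟨z, hz, hzle⟩ := hstep j v _ (Or.inr ⟨u, hA, _, hy, rfl⟩)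
    refine ⟨j + 1, z, hz, hzle.trans ?_⟩
    rcases hle.lt_or_eq with hlt | heq
    · rw [← hU u v hA q hq]
      exact hWI u v hA q p hq hp hlt
    · rw [heq, hU u v hA p hp]
  have hreach : ∀ v, ∀ τ ∈ NondomSet A s W v, ∃ j, ∀ k ≥ j, τ ∈ D k v := by
    intro v τ hτ
    rw [nondomSet_eq_minSet] at hτ
    obtain ⟨⟨p, hp, rfl⟩, hmin⟩ := hτ
    obtain ⟨j, hj⟩ := hpath v p hp
    refine ⟨j, fun k hk => ?_⟩
    obtain ⟨y, hy, hle⟩ := hmono v _ j hj k hk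
    rcases hle.lt_or_eq with hlt | rfl
    · exact (hmin ⟨y, hweights k v hy, hlt⟩).elim
    · exact hy
  have hevent : ∀ᶠ k in Filter.atTop, ∀ v, ∀ τ ∈ NondomSet A s W v, τ ∈ D k v := by
    refine Filter.eventually_all.2 fun v => ?_
    refine (Filter.eventually_all_finite (hWP.1.subset (Set.subset_iUnion _ v))).2 ?_
    exact fun τ hτ => Filter.eventually_atTop.2 (hreach v τ hτ)
  obtain ⟨K, hK⟩ := Filter.eventually_atTop.1 hevent
  refine ⟨K + 1, fun k hk v => Set.Subset.antisymm (fun τ hτ => ?_)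
    (hK k (K.le_succ.trans hk) v)⟩
  obtain ⟨σ, hσ, hle⟩ := (hwf v).exists_mem_minSet_le (hweights k v hτ)
  rw [← nondomSet_eq_minSet] at hσ
  rcases hle.lt_or_eq with hlt | rfl
  · obtain ⟨m, rfl⟩ : ∃ m, k = m + 1 := ⟨k - 1, by omega⟩
    have hmin := hτ
    rw [hDk] at hmin
    have hσD := hK (m + 1) (by omega) v σ hσ
    rw [hDk] at hσD
    exact (hmin.2 ⟨σ, hσD.1, hlt⟩).elim
  · exact hσ
end
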